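/- z_4(13) = 117: there exists a 13×13 (0,1)-matrix with 117 ones containing no all-one 4×4 minor, and every 13×13 (0,1)-matrix containing no all-one 4×4 minor has at most 117 ones. -/

import Mathlib

/-- An `m × n` (0,1)-matrix (entries as `Bool`) is `(a,b)`-admissible if it contains no
all-one `a × b` minor. -/
def Admissible {m n : ℕ} (a b : ℕ) (M : Fin m → Fin n → Bool) : Prop :=
  ¬ ∃ (R : Finset (Fin m)) (C : Finset (Fin n)),
      R.card = a ∧ C.card = b ∧ ∀ i ∈ R, ∀ j ∈ C, M i j = true

/-- The number of ones in a (0,1)-matrix. -/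
def onesCount {m n : ℕ} (M : Fin m → Fin n → Bool) : ℕ :=
  (Finset.univ.filter fun p : Fin m × Fin n => M p.1 p.2 = true).card

open Finset

section Counting

variable {ι κ : Type*} [DecidableEq κ]

/-- If every `k`-subset of `Q` lies in at most `m` of the sets `A i`, then the sets `A i` contain
at most `m * (#Q).choose k` subsets of size `k` altogether. -/
theorem sum_choose_card_le (I : Finset ι) (A : ι → Finset κ) (Q : Finset κ) (k m : ℕ)
    (hA : ∀ i ∈ I, A i ⊆ Q)
    (h : ∀ e ∈ powersetCard k Q, #{i ∈ I | e ⊆ A i} ≤ m) :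
    ∑ i ∈ I, (#(A i)).choose k ≤ m * (#Q).choose k := by
  have h1 : ∀ i ∈ I, (#(A i)).choose k = ∑ e ∈ powersetCard k Q, if e ⊆ A i then 1 else 0 := by
    intro i hi
    rw [← card_powersetCard, ← card_filter]
    congr 1
    ext e
    simp only [mem_powersetCard, mem_filter]
    exact ⟨fun h => ⟨⟨h.1.trans (hA i hi), h.2⟩, h.1⟩, fun h => ⟨h.2, h.1.2⟩⟩
  rw [sum_congr rfl h1, sum_comm]
  calc _ ≤ ∑ e ∈ powersetCard k Q, m := sum_le_sum fun e he => by
          rw [← card_filter]; exact h e he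
    _ = _ := by simp [mul_comm]

/-- Packing bound: sets meeting pairwise in fewer than `k` points share no `k`-subset. -/
theorem sum_choose_card_le_of_inter (I : Finset ι) (A : ι → Finset κ) (Q : Finset κ) (k : ℕ)
    (hA : ∀ i ∈ I, A i ⊆ Q) (h : ∀ i ∈ I, ∀ j ∈ I, i ≠ j → #(A i ∩ A j) < k) :
    ∑ i ∈ I, (#(A i)).choose k ≤ (#Q).choose k := by
  rw [← one_mul ((#Q).choose k)]
  refine sum_choose_card_le I A Q k 1 hA fun e he => card_le_one.2 fun i hi j hj => ?_
  by_contra hij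
  rw [mem_filter] at hi hj
  have := card_le_card (subset_inter hi.2 hj.2)
  rw [(mem_powersetCard.1 he).2] at this
  exact absurd (h i hi.1 j hj.1 hij) (not_lt.2 this)

theorem card_mul_le_sum (I : Finset ι) (w : ι → ℕ) (k : ℕ) (h : ∀ i ∈ I, k ≤ w i) :
    #I * k ≤ ∑ i ∈ I, w i := by
  simpa using card_nsmul_le_sum I w k h

/-- If all values are at least `k` and at most `t` of them are equal to `k`, the sum is at least
`#I * (k + 1) - t`. -/
theorem card_mul_succ_le_sum_add (I : Finset ι) (w : ι → ℕ) (k : ℕ) (h : ∀ i ∈ I, k ≤ w i) :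
    #I * (k + 1) ≤ ∑ i ∈ I, w i + #{i ∈ I | w i ≤ k} := by
  rw [card_filter, ← sum_add_distrib]
  refine card_mul_le_sum I _ _ fun i hi => ?_
  have := h i hi
  split_ifs <;> omega

theorem card_le_add_two {P A B : Finset κ} (h : #(P \ (A ∪ B)) ≤ 3) :
    #P + #((P ∩ A) ∩ (P ∩ B)) ≤ #(P ∩ A) + #(P ∩ B) + 3 := by
  have h1 := card_union_add_card_inter (P ∩ A) (P ∩ B)
  have h2 := card_sdiff_add_card_inter P (A ∪ B)
  rw [inter_union_distrib_left] at h2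
  omega

theorem card_le_add_three {P A B C : Finset κ} (h : #(P \ (A ∪ B ∪ C)) ≤ 3) :
    #P + #((P ∩ A) ∩ (P ∩ B)) + #((P ∩ A) ∩ (P ∩ C)) ≤
      #(P ∩ A) + #(P ∩ B) + #(P ∩ C) + 3 := by
  have h1 := card_union_add_card_inter (P ∩ A ∪ P ∩ B) (P ∩ C)
  have h2 := card_union_add_card_inter (P ∩ A) (P ∩ B)
  have h3 := card_sdiff_add_card_inter P (A ∪ B ∪ C)
  have h4 := card_le_card (inter_subset_inter_right (s := P ∩ A) (u := P ∩ C)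
    (subset_union_left (s₂ := P ∩ B)))
  rw [inter_union_distrib_left, inter_union_distrib_left] at h3
  omega

/-- Any two of the sets `D i`, `i ∈ I`, miss at most three points of `P` in common. -/
def PairCover (I : Finset ι) (D : ι → Finset κ) (P : Finset κ) : Prop :=
  ∀ a ∈ I, ∀ b ∈ I, a ≠ b → #(P \ (D a ∪ D b)) ≤ 3

/-- Any three of the sets `D i`, `i ∈ I`, miss at most three points of `P` in common. -/
def TripleCover (I : Finset ι) (D : ι → Finset κ) (P : Finset κ) : Prop :=
  ∀ a ∈ I, ∀ b ∈ I, ∀ c ∈ I, a ≠ b → a ≠ c → b ≠ c → #(P \ (D a ∪ D b ∪ D c)) ≤ 3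

variable {I : Finset ι} {D : ι → Finset κ} {P Q : Finset κ}

theorem TripleCover.mono (h : TripleCover I D P) (hQ : Q ⊆ P) : TripleCover I D Q :=
  fun a ha b hb c hc hab hac hbc =>
    (card_le_card (sdiff_subset_sdiff hQ Subset.rfl)).trans (h a ha b hb c hc hab hac hbc)

theorem TripleCover.pairCover [DecidableEq ι] (h : TripleCover I D P) {r : ι} (hr : r ∈ I) :
    PairCover (I.erase r) D (P \ D r) := by
  intro a ha b hb hab
  rw [mem_erase] at ha hb
  have := h r hr a ha.2 b hb.2 ha.1.symm hb.1.symm hab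
  rwa [sdiff_sdiff_left, sup_eq_union, ← union_assoc]

theorem PairCover.thirty_one_le [DecidableEq ι] (h : PairCover I D P)
    (hI : #I = 11) (hP : #P = 7) {j : ι}
    (hj : j ∈ I) (hw : #(P ∩ D j) ≤ 1) : 31 ≤ ∑ i ∈ I, #(P ∩ D i) := by
  have h1 := card_mul_le_sum (I.erase j) (fun i => #(P ∩ D i)) (4 - #(P ∩ D j)) fun i hi => by
    rw [mem_erase] at hi
    have := card_le_add_two (h i hi.2 j hj hi.1)
    omega
  rw [← add_sum_erase I _ hj]
  rw [card_erase_of_mem hj, hI] at h1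
  omega

theorem PairCover.thirty_le [DecidableEq ι] (h : PairCover I D P) (hI : #I = 11) (hP : #P = 7) :
    30 ≤ ∑ i ∈ I, #(P ∩ D i) := by
  by_cases hw : ∃ j ∈ I, #(P ∩ D j) ≤ 1
  · obtain ⟨j, hj, hw⟩ := hw
    exact (by norm_num : 30 ≤ 31).trans (h.thirty_one_le hI hP hj hw)
  push Not at hw
  have h1 := card_mul_succ_le_sum_add I (fun i => #(P ∩ D i)) 2 fun i hi => hw i hi
  have h2 := sum_choose_card_le_of_inter {i ∈ I | #(P ∩ D i) ≤ 2} (fun i => P ∩ D i) P 1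
    (fun _ _ => inter_subset_left) fun i hi j hj hij => by
      rw [mem_filter] at hi hj
      have := card_le_add_two (h i hi.1 j hj.1 hij)
      omega
  have h3 := card_mul_le_sum {i ∈ I | #(P ∩ D i) ≤ 2} (fun i => (#(P ∩ D i)).choose 1) 2
    fun i hi => by
      rw [Nat.choose_one_right]
      exact hw i (mem_filter.1 hi).1
  simp only [Nat.choose_one_right] at h2 h3
  omega

/-- At most `(#Q).choose 2 / 3` of the traces on `P` are triples lying in `Q`. -/
theorem PairCover.three_mul_card_le (h : PairCover I D P) (hP : #P = 8) {J : Finset ι}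
    (hJ : J ⊆ I) (hw : ∀ i ∈ J, #(P ∩ D i) = 3) (hQ : ∀ i ∈ J, P ∩ D i ⊆ Q) :
    3 * #J ≤ (#Q).choose 2 := by
  have h2 := sum_choose_card_le_of_inter J (fun i => P ∩ D i) Q 2 hQ fun i hi j hj hij => by
      have := card_le_add_two (h i (hJ hi) j (hJ hj) hij)
      have := hw i hi
      have := hw j hj
      omega
  rw [sum_congr rfl fun i hi => by rw [hw i hi]] at h2
  simpa [mul_comm, Nat.choose] using h2

theorem PairCover.thirty_five_le [DecidableEq ι] (h : PairCover I D P)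
    (hI : #I = 11) (hP : #P = 8) :
    35 ≤ ∑ i ∈ I, #(P ∩ D i) := by
  by_cases hw : ∃ j ∈ I, #(P ∩ D j) ≤ 2
  · obtain ⟨j, hj, hw⟩ := hw
    have h0 : ∀ i ∈ I.erase j, 5 + #((P ∩ D i) ∩ (P ∩ D j)) ≤ #(P ∩ D i) + #(P ∩ D j) := by
      intro i hi
      rw [mem_erase] at hi
      have := card_le_add_two (h i hi.2 j hj hi.1)
      omega
    rw [← add_sum_erase I _ hj]
    have hIj : #(I.erase j) = 10 := by rw [card_erase_of_mem hj, hI]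
    rcases Nat.lt_or_ge (#(P ∩ D j)) 2 with hlt | hge
    · have h1 := card_mul_le_sum (I.erase j) (fun i => #(P ∩ D i)) 4 fun i hi => by
        have := h0 i hi
        omega
      omega
    · have h1 := card_mul_succ_le_sum_add (I.erase j) (fun i => #(P ∩ D i)) 3 fun i hi => by
        have := h0 i hi
        omega
      have h2 := h.three_mul_card_le (Q := P \ D j) hP
        (J := {i ∈ I.erase j | #(P ∩ D i) ≤ 3})
        ((filter_subset _ _).trans (erase_subset _ _))
        (fun i hi => by
          rw [mem_filter] at hi
          have := h0 i hi.1
          omega)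
        (fun i hi x hx => by
          rw [mem_filter] at hi
          have := h0 i hi.1
          have h3 : P ∩ D i ∩ (P ∩ D j) = ∅ := by
            rw [← card_eq_zero]
            omega
          have h4 : x ∉ P ∩ D i ∩ (P ∩ D j) := by simp [h3]
          simp only [mem_inter, mem_sdiff] at hx h4 ⊢
          tauto)
      have h3 := card_sdiff_add_card_inter P (D j)
      have h4 : #(P \ D j) = 6 := by omega
      rw [h4, show Nat.choose 6 2 = 15 from rfl] at h2
      omega
  · push Not at hw
    have h1 := card_mul_succ_le_sum_add I (fun i => #(P ∩ D i)) 3 fun i hi => hw i hi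
    have h2 := h.three_mul_card_le (Q := P) hP (J := {i ∈ I | #(P ∩ D i) ≤ 3})
      (filter_subset _ _)
      (fun i hi => by
        rw [mem_filter] at hi
        have := hw i hi.1
        omega)
      (fun i hi => inter_subset_left)
    rw [hP, show Nat.choose 8 2 = 28 from rfl] at h2
    omega

/-- A bound from the two smallest traces. -/
theorem TripleCover.exists_two_smallest [DecidableEq ι] (h : TripleCover I D P) (hI : #I = 12) :
    ∃ x y : ℕ, x ≤ y ∧ x + y + 10 * max y (#P - 3 - x - y) ≤ ∑ i ∈ I, #(P ∩ D i) := by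
  obtain ⟨a, ha, hmin⟩ := exists_min_image I (fun i => #(P ∩ D i)) (card_pos.1 (by omega))
  have hIa : #(I.erase a) = 11 := by rw [card_erase_of_mem ha, hI]
  obtain ⟨b, hb, hmin'⟩ := exists_min_image (I.erase a) (fun i => #(P ∩ D i))
    (card_pos.1 (by omega))
  have hIb : #((I.erase a).erase b) = 10 := by rw [card_erase_of_mem hb, hIa]
  refine ⟨_, _, hmin b (mem_of_mem_erase hb), ?_⟩
  rw [← add_sum_erase I _ ha, ← add_sum_erase _ _ hb, ← hIb, add_assoc]
  gcongr
  refine card_mul_le_sum _ _ _ fun i hi => max_le (hmin' i (mem_of_mem_erase hi)) ?_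
  rw [mem_erase, mem_erase] at hi
  have := card_le_add_three (h a ha b (mem_of_mem_erase hb) i hi.2.2
    (ne_of_mem_erase hb).symm hi.2.1.symm hi.1.symm)
  omega

theorem TripleCover.twelve_le [DecidableEq ι] (h : TripleCover I D P)
    (hI : #I = 12) (hP : #P = 6) :
    12 ≤ ∑ i ∈ I, #(P ∩ D i) := by
  obtain ⟨x, y, hxy, h⟩ := h.exists_two_smallest hI
  omega

theorem TripleCover.twenty_two_le [DecidableEq ι] (h : TripleCover I D P)
    (hI : #I = 12) (hP : #P = 7) :
    22 ≤ ∑ i ∈ I, #(P ∩ D i) := by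
  obtain ⟨x, y, hxy, h⟩ := h.exists_two_smallest hI
  omega

/-- Removing a point splits off its degree. -/
theorem sum_card_inter_erase {j : κ} (hj : j ∈ P) :
    ∑ i ∈ I, #(P ∩ D i) = ∑ i ∈ I, #(P.erase j ∩ D i) + #{i ∈ I | j ∈ D i} := by
  rw [card_filter, ← sum_add_distrib]
  refine sum_congr rfl fun i _ => ?_
  rw [erase_inter]
  split_ifs with hji
  · rw [card_erase_add_one (mem_inter.2 ⟨hj, hji⟩)]
  · rw [erase_eq_of_notMem (fun hx => hji (mem_inter.1 hx).2), add_zero]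

/-- If one trace has at most one point, some point `j` of `P` can be removed, together with that
trace, so that the remaining traces lose at least one point. -/
theorem TripleCover.exists_erase [DecidableEq ι] (h : TripleCover I D P)
    (hI : 4 ≤ #I) (hP : 4 ≤ #P) {r : ι} (hr : r ∈ I) (hw : #(P ∩ D r) ≤ 1) :
    ∃ j ∈ P, PairCover (I.erase r) D (P.erase j) ∧
      1 + ∑ i ∈ I.erase r, #(P.erase j ∩ D i) ≤ ∑ i ∈ I, #(P ∩ D i) := by
  have key : ∃ j ∈ P, P ∩ D r ⊆ {j} ∧ ∃ i ∈ I, j ∈ D i := by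
    rcases (P ∩ D r).eq_empty_or_nonempty with h0 | ⟨j, hj⟩
    · obtain ⟨x, hx⟩ : ∃ x ∈ I, ∃ j ∈ P, j ∈ D x := by
        by_contra hcon
        push Not at hcon
        obtain ⟨a, b, c, ha, hb, hc, hab, hac, hbc⟩ := two_lt_card_iff.1 (by omega : 2 < #I)
        have h1 := h a ha b hb c hc hab hac hbc
        rw [sdiff_eq_self_of_disjoint] at h1
        · omega
        · rw [disjoint_left]
          intro x hx
          simp [hcon a ha x hx, hcon b hb x hx, hcon c hc x hx]
      obtain ⟨hx, j, hj, hjx⟩ := hx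
      exact ⟨j, hj, by simp [h0], x, hx, hjx⟩
    · refine ⟨j, (mem_inter.1 hj).1, fun x hx => ?_, r, hr, (mem_inter.1 hj).2⟩
      rw [mem_singleton]
      exact card_le_one.1 hw x hx j hj
  obtain ⟨j, hj, hsub, x, hx, hjx⟩ := key
  refine ⟨j, hj, ?_, ?_⟩
  · intro a ha b hb hab
    refine le_trans (card_le_card ?_) (h.pairCover hr a ha b hb hab)
    refine sdiff_subset_sdiff (fun y hy => ?_) Subset.rfl
    rw [mem_erase] at hy
    refine mem_sdiff.2 ⟨hy.2, fun hyr => hy.1 ?_⟩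
    exact mem_singleton.1 (hsub (mem_inter.2 ⟨hy.2, hyr⟩))
  · rw [sum_card_inter_erase hj, add_comm]
    refine add_le_add (sum_le_sum_of_subset (erase_subset _ _)) ?_
    exact card_pos.2 ⟨x, mem_filter.2 ⟨hx, hjx⟩⟩

theorem TripleCover.thirty_le [DecidableEq ι] (h : TripleCover I D P) (hI : #I = 12)
    (hP : #P = 8) : 30 ≤ ∑ i ∈ I, #(P ∩ D i) := by
  by_cases hw : ∃ r ∈ I, #(P ∩ D r) ≤ 1
  · obtain ⟨r, hr, hw⟩ := hw
    obtain ⟨j, hj, hpair, hle⟩ := h.exists_erase (by omega) (by omega) hr hw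
    have := hpair.thirty_le (by rw [card_erase_of_mem hr, hI])
      (by rw [card_erase_of_mem hj, hP])
    omega
  push Not at hw
  have h1 := card_mul_succ_le_sum_add I (fun i => #(P ∩ D i)) 2 fun i hi => hw i hi
  suffices hT : #{i ∈ I | #(P ∩ D i) ≤ 2} ≤ 6 by omega
  by_contra! hT
  set T := {i ∈ I | #(P ∩ D i) ≤ 2} with hTdef
  have hTw : ∀ i ∈ T, i ∈ I ∧ #(P ∩ D i) = 2 := fun i hi => by
    rw [hTdef, mem_filter] at hi
    have := hw i hi.1
    exact ⟨hi.1, by omega⟩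
  have hdeg : ∀ e ∈ T, ∀ S ⊆ T.erase e,
      #S ≤ #{i ∈ S | #((P ∩ D e) ∩ (P ∩ D i)) = 0} + 1 := by
    intro e he S hS
    rw [← card_filter_add_card_filter_not (s := S) fun i => #((P ∩ D e) ∩ (P ∩ D i)) = 0]
    gcongr
    refine card_le_one.2 fun i hi k hk => ?_
    by_contra hik
    rw [mem_filter] at hi hk
    have hi' := mem_erase.1 (hS hi.1)
    have hk' := mem_erase.1 (hS hk.1)
    have := card_le_add_three (h e (hTw e he).1 i (hTw i hi'.2).1 k (hTw k hk'.2).1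
      hi'.1.symm hk'.1.symm hik)
    have := (hTw e he).2
    have := (hTw i hi'.2).2
    have := (hTw k hk'.2).2
    omega
  obtain ⟨e, he⟩ : T.Nonempty := card_pos.1 (by omega)
  have hd := hdeg e he _ Subset.rfl
  rw [card_erase_of_mem he] at hd
  set T₁ := {i ∈ T.erase e | #((P ∩ D e) ∩ (P ∩ D i)) = 0} with hT₁
  obtain ⟨f, hf⟩ : T₁.Nonempty := card_pos.1 (by omega)
  have hf' := hf
  rw [hT₁, mem_filter, mem_erase] at hf'
  have hd' := hdeg f hf'.1.2 (T₁.erase f)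
    (erase_subset_erase f ((filter_subset _ _).trans (erase_subset _ _)))
  rw [card_erase_of_mem hf] at hd'
  obtain ⟨a, b, c, ha, hb, hc, hab, hac, hbc⟩ :=
    two_lt_card_iff.1 (by omega : 2 < #{i ∈ T₁.erase f | #((P ∩ D f) ∩ (P ∩ D i)) = 0})
  simp only [hT₁, mem_filter, mem_erase, card_eq_zero, ← disjoint_iff_inter_eq_empty] at ha hb hc
  have h2 := h a (hTw a ha.1.2.1.2).1 b (hTw b hb.1.2.1.2).1 c (hTw c hc.1.2.1.2).1 hab hac hbc
  have h3 : P ∩ D e ∪ P ∩ D f ⊆ P \ (D a ∪ D b ∪ D c) := by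
    have hdis : ∀ i x, x ∈ P ∩ D e ∪ P ∩ D f → Disjoint (P ∩ D e) (P ∩ D i) →
        Disjoint (P ∩ D f) (P ∩ D i) → x ∉ D i := by
      intro i x hx he hf hxi
      rw [disjoint_left] at he hf
      simp only [mem_union, mem_inter] at hx he hf
      rcases hx with hx | hx
      · exact he hx ⟨hx.1, hxi⟩
      · exact hf hx ⟨hx.1, hxi⟩
    intro x hx
    have hxP : x ∈ P := by
      simp only [mem_union, mem_inter] at hx
      tauto
    simp only [mem_sdiff, mem_union, not_or]
    exact ⟨hxP, ⟨hdis a x hx ha.1.2.2 ha.2, hdis b x hx hb.1.2.2 hb.2⟩,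
      hdis c x hx hc.1.2.2 hc.2⟩
  have h4 := card_le_card h3
  have h5 := card_union_add_card_inter (P ∩ D e) (P ∩ D f)
  have := (hTw e he).2
  have := (hTw f hf'.1.2).2
  omega

/-- Among the sets disjoint from a two-point trace, complements satisfy a packing bound. -/
theorem TripleCover.sum_choose_le (h : TripleCover I D P) {r : ι}
    (hw : #(P ∩ D r) = 2) {J : Finset ι} (hJ : J ⊆ I)
    (hd : ∀ i ∈ J, Disjoint (P ∩ D r) (D i)) :
    ∑ i ∈ J, (#((P \ D r) \ D i)).choose 2 ≤ 2 * (#(P \ D r)).choose 2 := by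
  refine sum_choose_card_le J (fun i => (P \ D r) \ D i) _ 2 2 (fun i _ => sdiff_subset) ?_
  intro e he
  rw [mem_powersetCard] at he
  by_contra! hlt
  obtain ⟨a, b, c, ha, hb, hc, hab, hac, hbc⟩ := two_lt_card_iff.1 hlt
  rw [mem_filter] at ha hb hc
  have h1 := h a (hJ ha.1) b (hJ hb.1) c (hJ hc.1) hab hac hbc
  have h2 : e ∪ P ∩ D r ⊆ P \ (D a ∪ D b ∪ D c) := by
    have hdis : ∀ i, Disjoint (P ∩ D r) (D i) → e ⊆ (P \ D r) \ D i →
        ∀ x ∈ e ∪ P ∩ D r, x ∉ D i := by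
      intro i hi hei x hx
      rcases mem_union.1 hx with hx | hx
      · exact (mem_sdiff.1 (hei hx)).2
      · exact disjoint_left.1 hi hx
    refine fun x hx => mem_sdiff.2 ⟨?_, ?_⟩
    · rcases mem_union.1 hx with hx | hx
      · exact sdiff_subset (he.1 hx)
      · exact (mem_inter.1 hx).1
    · simp only [mem_union, not_or]
      exact ⟨⟨hdis a (hd a ha.1) ha.2 x hx, hdis b (hd b hb.1) hb.2 x hx⟩,
        hdis c (hd c hc.1) hc.2 x hx⟩
  have h3 := card_le_card h2
  rw [card_union_of_disjoint, he.2, hw] at h3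
  · omega
  · exact disjoint_left.2 fun x hx hx' => (mem_sdiff.1 (he.1 hx)).2 (mem_inter.1 hx').2

theorem TripleCover.thirty_six_le [DecidableEq ι] (h : TripleCover I D P) (hI : #I = 12)
    (hP : #P = 9) : 36 ≤ ∑ i ∈ I, #(P ∩ D i) := by
  by_cases hw : ∃ r ∈ I, #(P ∩ D r) ≤ 1
  · obtain ⟨r, hr, hw⟩ := hw
    obtain ⟨j, hj, hpair, hle⟩ := h.exists_erase (by omega) (by omega) hr hw
    have := hpair.thirty_five_le (by rw [card_erase_of_mem hr, hI])
      (by rw [card_erase_of_mem hj, hP])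
    omega
  push Not at hw
  by_contra! hlt
  obtain ⟨r, hr, hr2⟩ : ∃ r ∈ I, #(P ∩ D r) = 2 := by
    by_contra! hne
    have := card_mul_le_sum I (fun i => #(P ∩ D i)) 3 fun i hi => by
      have := hw i hi
      have := hne i hi
      omega
    omega
  have hIr : #(I.erase r) = 11 := by rw [card_erase_of_mem hr, hI]
  have hN : #(P \ D r) = 7 := by
    have := card_sdiff_add_card_inter P (D r)
    omega
  have hpair := h.pairCover hr
  have h30 := hpair.thirty_le hIr hN
  rw [← add_sum_erase I _ hr] at hlt
  have hsplit : ∀ i, #(P ∩ D i) = #((P \ D r) ∩ D i) + #((P ∩ D r) ∩ D i) := fun i => by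
    rw [← card_union_of_disjoint, ← union_inter_distrib_right, sdiff_union_inter]
    exact (disjoint_sdiff_inter P (D r)).mono inter_subset_left inter_subset_left
  have hsum : ∑ i ∈ I.erase r, #(P ∩ D i) =
      ∑ i ∈ I.erase r, #((P \ D r) ∩ D i) + ∑ i ∈ I.erase r, #((P ∩ D r) ∩ D i) := by
    rw [← sum_add_distrib]
    exact sum_congr rfl fun i _ => hsplit i
  set J := {i ∈ I.erase r | #((P ∩ D r) ∩ D i) = 0} with hJ
  set K := {i ∈ I.erase r | ¬ #((P ∩ D r) ∩ D i) = 0} with hK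
  have hJK : #J + #K = 11 := by rw [← hIr, hJ, hK, card_filter_add_card_filter_not]
  have hsumJK : ∑ i ∈ J, #(P ∩ D i) + ∑ i ∈ K, #(P ∩ D i) =
      ∑ i ∈ I.erase r, #(P ∩ D i) := sum_filter_add_sum_filter_not _ _ _
  have hKle : #K ≤ ∑ i ∈ I.erase r, #((P ∩ D r) ∩ D i) := by
    rw [hK, card_filter]
    refine sum_le_sum fun i _ => ?_
    split_ifs <;> omega
  have hpack := h.sum_choose_le hr2 (J := J) ((filter_subset _ _).trans (erase_subset _ _))
    fun i hi => by
      rw [hJ, mem_filter, card_eq_zero] at hi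
      exact disjoint_iff_inter_eq_empty.2 hi.2
  rw [hN, show Nat.choose 7 2 = 21 from rfl] at hpack
  have hJle := card_mul_le_sum J
    (fun i => (#((P \ D r) \ D i)).choose 2 + 3 * #(P ∩ D i)) 15 fun i hi => by
      rw [hJ, mem_filter] at hi
      have h1 := card_sdiff_add_card_inter (P \ D r) (D i)
      have h2 := hsplit i
      rw [hi.2, add_zero] at h2
      rw [hN, ← h2] at h1
      have h3 : #(P ∩ D i) = 7 - #((P \ D r) \ D i) := by omega
      rw [h3]
      have h4 : #((P \ D r) \ D i) ≤ 7 := by omega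
      generalize #((P \ D r) \ D i) = m at h4 ⊢
      interval_cases m <;> decide
  rw [sum_add_distrib, ← mul_sum] at hJle
  by_cases hsmall : ∃ j ∈ I.erase r, #((P \ D r) ∩ D j) ≤ 1
  · obtain ⟨j, hj, hj1⟩ := hsmall
    have h31 := hpair.thirty_one_le hIr hN hj hj1
    have hK2 := card_mul_le_sum K (fun i => #(P ∩ D i)) 2 fun i hi =>
      hw i (mem_of_mem_erase (mem_filter.1 hi).1)
    omega
  · push Not at hsmall
    have hK3 := card_mul_le_sum K (fun i => #(P ∩ D i)) 3 fun i hi => by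
      have h1 := hsplit i
      have h2 := hsmall i (mem_filter.1 hi).1
      have h3 := (mem_filter.1 hi).2
      omega
    omega

theorem TripleCover.four_mul_card_le [DecidableEq ι] (h : TripleCover I D P) (hI : #I = 12)
    (hP : 9 ≤ #P) : 4 * #P ≤ ∑ i ∈ I, #(P ∩ D i) := by
  obtain ⟨n, hn⟩ : ∃ n, #P = n := ⟨_, rfl⟩
  rw [hn] at hP ⊢
  induction n, hP using Nat.le_induction generalizing P with
  | base => exact h.thirty_six_le hI hn
  | succ n hn9 ih =>
    obtain ⟨j, hj, hj4⟩ : ∃ j ∈ P, 4 ≤ #{i ∈ I | j ∈ D i} := by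
      by_contra! hlt
      obtain ⟨Q, hQ, hQ9⟩ := exists_subset_card_eq (by omega : 9 ≤ #P)
      have h1 := (h.mono hQ).thirty_six_le hI hQ9
      have h2 : ∑ i ∈ I, #(Q ∩ D i) = ∑ j ∈ Q, #{i ∈ I | j ∈ D i} := by
        simp only [card_filter]
        rw [sum_comm]
        refine sum_congr rfl fun i _ => ?_
        rw [← card_filter, filter_mem_eq_inter]
      have h3 := sum_le_card_nsmul Q (fun j => #{i ∈ I | j ∈ D i}) 3 fun j hj =>
        Nat.lt_succ_iff.1 (hlt j (hQ hj))
      rw [hQ9, smul_eq_mul] at h3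
      omega
    have h1 : #(P.erase j) = n := by rw [card_erase_of_mem hj, hn]; rfl
    have h2 := ih (h.mono (erase_subset j P)) h1
    rw [sum_card_inter_erase hj]
    omega

/-- The zeros outside the zero columns of a row having `s` zeros, in a `13 × 13` matrix. -/
theorem TripleCover.quadratic_le [DecidableEq ι] (h : TripleCover I D P) (hI : #I = 12) {s : ℕ}
    (hP : #P + s = 13) : 40 + 3 * s ≤ ∑ i ∈ I, #(P ∩ D i) + s ^ 2 := by
  rcases le_or_gt 9 #P with h9 | h9
  · have := h.four_mul_card_le hI h9
    have hs : s ≤ 4 := by omega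
    interval_cases s <;> omega
  · rcases le_or_gt 8 s with h8 | h8
    · have hs : s ≤ 13 := by omega
      interval_cases s <;> omega
    · have hs : s = 5 ∨ s = 6 ∨ s = 7 := by omega
      rcases hs with rfl | rfl | rfl
      · have := h.thirty_le hI (by omega)
        omega
      · have := h.twenty_two_le hI (by omega)
        omega
      · have := h.twelve_le hI (by omega)
        omega

/-- If any four of thirteen subsets of a `13`-set cover all but at most three points, and their
total size is at most `51`, the sum of squared degrees is below the sum of squared sizes. -/
theorem sum_degree_sq_lt {Z : Fin 13 → Finset (Fin 13)}
    (hZ : ∀ r, TripleCover (univ.erase r) Z (univ \ Z r)) (hsum : ∑ i, #(Z i) ≤ 51) :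
    ∑ j, #{i | j ∈ Z i} ^ 2 < ∑ i, #(Z i) ^ 2 := by
  have hrow : ∀ r, 40 + 3 * #(Z r) + ∑ i, #(Z r ∩ Z i) ≤ ∑ i, #(Z i) + #(Z r) ^ 2 := by
    intro r
    have hcard := card_sdiff_add_card_inter univ (Z r)
    rw [univ_inter, card_univ, Fintype.card_fin] at hcard
    have h1 := (hZ r).quadratic_le (by rw [card_erase_of_mem (mem_univ r)]; rfl) hcard
    have h2 : ∑ i ∈ univ.erase r, #((univ \ Z r) ∩ Z i) + ∑ i, #(Z r ∩ Z i) =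
        ∑ i, #(Z i) := by
      rw [sum_erase _ (by simp), ← sum_add_distrib]
      refine sum_congr rfl fun i _ => ?_
      rw [← card_union_of_disjoint, ← union_inter_distrib_right]
      · rw [sdiff_union_of_subset (subset_univ _), univ_inter]
      · exact (sdiff_disjoint).mono inter_subset_left inter_subset_left
    omega
  have hdeg : ∑ r, ∑ i, #(Z r ∩ Z i) = ∑ j, #{i | j ∈ Z i} ^ 2 := by
    have h1 : ∀ r i, #(Z r ∩ Z i) =
        ∑ j, (if j ∈ Z r then 1 else 0) * (if j ∈ Z i then 1 else 0) := by
      intro r i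
      rw [← filter_univ_mem (Z r ∩ Z i), card_filter]
      refine sum_congr rfl fun j _ => ?_
      by_cases hr : j ∈ Z r <;> by_cases hi : j ∈ Z i <;> simp [hr, hi]
    simp only [h1, card_filter, sq, sum_mul_sum]
    rw [sum_congr rfl fun i _ => sum_comm, sum_comm]
  have htot := sum_le_sum fun r (_ : r ∈ univ) => hrow r
  simp only [sum_add_distrib, ← mul_sum, sum_const, card_univ, Fintype.card_fin,
    smul_eq_mul] at htot
  rw [hdeg] at htot
  omega

end Counting

theorem Admissible.transpose {m n a b : ℕ} {M : Fin m → Fin n → Bool} (h : Admissible a b M) :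
    Admissible b a fun j i => M i j :=
  fun ⟨R, C, hR, hC, hRC⟩ => h ⟨C, R, hC, hR, fun i hi j hj => hRC j hj i hi⟩

theorem onesCount_add_sum_zeros {m n : ℕ} (M : Fin m → Fin n → Bool) :
    onesCount M + ∑ i, #{j | M i j = false} = m * n := by
  have h1 : onesCount M = ∑ i, #{j | M i j = true} := by
    rw [onesCount, card_filter, ← univ_product_univ, sum_product]
    exact sum_congr rfl fun i _ => (card_filter _ _).symm
  rw [h1, ← sum_add_distrib]
  have h2 : ∀ i, #{j | M i j = true} + #{j | M i j = false} = n := fun i => by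
    simpa using card_filter_add_card_filter_not (s := univ) fun j => M i j = true
  simp [h2]

theorem Admissible.tripleCover {M : Fin 13 → Fin 13 → Bool} (h : Admissible 4 4 M) (r : Fin 13) :
    TripleCover (univ.erase r) (fun i => {j | M i j = false})
      (univ \ ({j | M r j = false} : Finset (Fin 13))) := by
  intro a ha b hb c hc hab hac hbc
  by_contra! hlt
  obtain ⟨C, hC, hC4⟩ := exists_subset_card_eq (Nat.succ_le_of_lt hlt)
  rw [mem_erase] at ha hb hc
  refine h ⟨{r, a, b, c}, C, ?_, hC4, fun i hi j hj => ?_⟩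
  · rw [card_insert_of_notMem, card_insert_of_notMem, card_pair hbc]
    · simp [hab, hac]
    · simp [ha.1.symm, hb.1.symm, hc.1.symm]
  · have := hC hj
    simp only [mem_sdiff, mem_union, mem_filter, mem_univ, true_and, Bool.not_eq_false,
      not_or] at this
    simp only [mem_insert, mem_singleton] at hi
    obtain ⟨hr, ⟨hja, hjb⟩, hjc⟩ := this
    rcases hi with rfl | rfl | rfl | rfl <;> assumption

theorem Admissible.sum_sq_lt {M : Fin 13 → Fin 13 → Bool} (h : Admissible 4 4 M)
    (hones : 118 ≤ onesCount M) :
    ∑ j, #{i | M i j = false} ^ 2 < ∑ i, #{j | M i j = false} ^ 2 := by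
  have h0 := onesCount_add_sum_zeros M
  have h1 := sum_degree_sq_lt h.tripleCover (by omega)
  simpa using h1

/-- Sets of size `q` meeting pairwise in at most one point are nearly disjoint. -/
theorem mul_card_le_card_biUnion {ι κ : Type*} [DecidableEq ι] [DecidableEq κ] {Z : ι → Finset κ}
    {q : ℕ} (R : Finset ι) (hq : ∀ i ∈ R, #(Z i) = q)
    (h : ∀ i ∈ R, ∀ j ∈ R, i ≠ j → #(Z i ∩ Z j) ≤ 1) :
    q * #R ≤ #(R.biUnion Z) + (#R).choose 2 := by
  induction R using Finset.induction_on with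
  | empty => simp
  | insert a R ha ih =>
    have h1 := ih (fun i hi => hq i (mem_insert_of_mem hi)) fun i hi j hj =>
      h i (mem_insert_of_mem hi) j (mem_insert_of_mem hj)
    have h2 : #(Z a ∩ R.biUnion Z) ≤ #R := by
      rw [inter_biUnion]
      refine card_biUnion_le.trans ((sum_le_card_nsmul R _ 1 fun i hi => ?_).trans (by simp))
      exact h a (mem_insert_self a R) i (mem_insert_of_mem hi) fun hai => ha (hai ▸ hi)
    have h3 := card_union_add_card_inter (Z a) (R.biUnion Z)
    rw [hq a (mem_insert_self a R)] at h3
    rw [biUnion_insert, card_insert_of_notMem ha, Nat.choose_succ_succ' _ 1,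
      one_add_one_eq_two, Nat.choose_one_right, mul_add]
    omega

/-- The complement of the incidence matrix of the projective plane of order three, from the
difference set `{0, 1, 3, 9}` modulo `13`. -/
def planeComplement (i j : Fin 13) : Bool :=
  decide (j ≠ i ∧ j ≠ i + 1 ∧ j ≠ i + 3 ∧ j ≠ i + 9)

theorem card_zeros_planeComplement : ∀ i : Fin 13, #{j | planeComplement i j = false} = 4 := by
  decide +kernel

theorem card_inter_zeros_planeComplement (i j : Fin 13) (hij : i ≠ j) :
    #(({k | planeComplement i k = false} : Finset (Fin 13)) ∩
      ({k | planeComplement j k = false} : Finset (Fin 13))) ≤ 1 := by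
  revert i j
  decide +kernel

theorem admissible_planeComplement : Admissible 4 4 planeComplement := by
  rintro ⟨R, C, hR, hC, hRC⟩
  have h1 := mul_card_le_card_biUnion R (fun i _ => card_zeros_planeComplement i)
    fun i _ j _ hij => card_inter_zeros_planeComplement i j hij
  have h2 : Disjoint C (R.biUnion fun i => {j | planeComplement i j = false}) := by
    refine disjoint_left.2 fun j hj hj' => ?_
    obtain ⟨i, hi, hij⟩ := mem_biUnion.1 hj'
    simp [hRC i hi j hj] at hij
  have h3 := card_le_univ (C ∪ R.biUnion fun i => {j | planeComplement i j = false})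
  rw [card_union_of_disjoint h2, hC, Fintype.card_fin] at h3
  rw [hR, show Nat.choose 4 2 = 6 from rfl] at h1
  omega

/-- `z_4(13, 13) = 117`. -/
theorem stmt19 :
    (∃ M : Fin 13 → Fin 13 → Bool, Admissible 4 4 M ∧ onesCount M = 117) ∧
      ∀ M : Fin 13 → Fin 13 → Bool, Admissible 4 4 M → onesCount M ≤ 117 := by
  refine ⟨⟨planeComplement, admissible_planeComplement, ?_⟩, fun M hM => ?_⟩
  · have h := onesCount_add_sum_zeros planeComplement
    simp only [card_zeros_planeComplement, sum_const, card_univ, Fintype.card_fin,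
      smul_eq_mul] at h
    omega
  by_contra! hlt
  have h1 := onesCount_add_sum_zeros M
  have h2 := onesCount_add_sum_zeros fun j i => M i j
  have h3 : ∑ i, #{j | M i j = false} = ∑ j, #{i | M i j = false} := by
    simp only [card_filter]
    exact sum_comm
  exact lt_asymm (hM.sum_sq_lt hlt) (hM.transpose.sum_sq_lt (by omega))
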